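/- For any subspace 𝒱 of ℝ^{p₁·p₂} and any τ ≥ √p₂, the robust dimensions of the column projections satisfy Σ_{i ∈ [p₂]} dim_i^τ(𝒱) ≥ dim(𝒱). -/

import Mathlib

noncomputable section

/-- Euclidean norm of a vector indexed by a finite type. -/
def enorm2 {ι : Type*} [Fintype ι] (x : ι → ℝ) : ℝ :=
  Real.sqrt (∑ i, x i ^ 2)

/-- Robust dimension of the projection of a subspace 𝒱 of p₁ × p₂ matrices to the
i-th column: the largest d for which there are orthonormal v₁,…,v_d ∈ ℝ^{p₁} and
M₁,…,M_d ∈ 𝒱 with ‖M_t‖ ≤ τ and v_t equal to the i-th column of M_t. -/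
def robustDim {p₁ p₂ : ℕ} (V : Submodule ℝ (Matrix (Fin p₁) (Fin p₂) ℝ)) (τ : ℝ)
    (i : Fin p₂) : ℕ :=
  sSup {d : ℕ | ∃ v : Fin d → (Fin p₁ → ℝ), ∃ M : Fin d → Matrix (Fin p₁) (Fin p₂) ℝ,
    (∀ t, enorm2 (v t) = 1) ∧
    (∀ s t, s ≠ t → (∑ p, v s p * v t p) = 0) ∧
    (∀ t, M t ∈ V ∧ enorm2 (fun pq : Fin p₁ × Fin p₂ => M t pq.1 pq.2) ≤ τ ∧
      (fun p => M t p i) = v t)}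

open scoped InnerProductSpace

/-- A linear map `A` between Euclidean spaces admits vectors of norm at most `τ` with orthonormal
images such that `A` is strictly `τ⁻¹`-contracting on their orthogonal complement. -/
theorem LinearMap.exists_orthonormal_image_norm_le {E F : Type*}
    [NormedAddCommGroup E] [InnerProductSpace ℝ E] [FiniteDimensional ℝ E]
    [NormedAddCommGroup F] [InnerProductSpace ℝ F] [FiniteDimensional ℝ F]
    (A : E →ₗ[ℝ] F) {τ : ℝ} (hτ : 0 < τ) :
    ∃ (d : ℕ) (M : Fin d → E), Orthonormal ℝ (fun t => A (M t)) ∧ (∀ t, ‖M t‖ ≤ τ) ∧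
      ∀ x, x ≠ 0 → (∀ t, ⟪M t, x⟫_ℝ = 0) → τ ^ 2 * ‖A x‖ ^ 2 < ‖x‖ ^ 2 := by
  have hT : (A.adjoint ∘ₗ A).IsSymmetric := fun x y => by
    simp [LinearMap.adjoint_inner_left, LinearMap.adjoint_inner_right]
  let b := hT.eigenvectorBasis rfl
  let ev := hT.eigenvalues rfl
  have hAb : ∀ s x, ⟪A (b s), A x⟫_ℝ = ev s * ⟪b s, x⟫_ℝ := fun s x => by
    have h := hT.apply_eigenvectorBasis rfl s
    rw [← LinearMap.adjoint_inner_left, ← LinearMap.comp_apply, h, real_inner_smul_left]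
    rfl
  have hAx : ∀ x, ‖A x‖ ^ 2 = ∑ s, ev s * ⟪b s, x⟫_ℝ ^ 2 := fun x => by
    rw [← real_inner_self_eq_norm_sq]
    conv_lhs => enter [2]; rw [← b.sum_repr' x]
    simp only [map_sum, map_smul, sum_inner, real_inner_smul_left, hAb]
    exact Finset.sum_congr rfl fun s _ => by ring
  let S := {t // 1 ≤ τ ^ 2 * ev t}
  have hpos : ∀ t : S, 0 < ev t := fun t => by
    have := t.2
    by_contra! h
    nlinarith [mul_nonneg (sq_nonneg τ) (neg_nonneg.2 h)]
  let e := Fintype.equivFin S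
  refine ⟨Fintype.card S, fun k => (√(ev (e.symm k)))⁻¹ • b (e.symm k), ?_, ?_, ?_⟩
  · rw [orthonormal_iff_ite]
    intro s t
    have hs := hpos (e.symm s)
    simp only [map_smul, real_inner_smul_left, real_inner_smul_right, hAb,
      orthonormal_iff_ite.1 b.orthonormal]
    by_cases hst : s = t
    · subst hst
      have h := Real.mul_self_sqrt hs.le
      have h0 := Real.sqrt_pos.2 hs
      simp only [if_true]
      field_simp
      linarith
    · have : (e.symm s).1 ≠ (e.symm t).1 := fun h => hst (e.symm.injective (Subtype.ext h))
      simp [hst, this]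
  · intro k
    have hs := hpos (e.symm k)
    have h1 := (e.symm k).2
    rw [norm_smul, b.orthonormal.1, mul_one, norm_inv, Real.norm_of_nonneg (Real.sqrt_nonneg _)]
    refine inv_le_of_inv_le₀ hτ (Real.le_sqrt_of_sq_le ?_)
    rw [inv_pow]
    exact inv_le_of_inv_le₀ hs ((inv_le_iff_one_le_mul₀ hs).2 h1)
  · intro x hx hM
    have hS : ∀ s, 1 ≤ τ ^ 2 * ev s → ⟪b s, x⟫_ℝ = 0 := fun s hs => by
      have h := hM (e ⟨s, hs⟩)
      have h0 := Real.sqrt_pos.2 (hpos ⟨s, hs⟩)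
      simpa [real_inner_smul_left, h0.ne'] using h
    have hx2 : ∑ s, ⟪b s, x⟫_ℝ ^ 2 = ‖x‖ ^ 2 := by
      simpa using b.sum_sq_norm_inner_right x
    rw [hAx, ← hx2, Finset.mul_sum]
    have hterm : ∀ s, ⟪b s, x⟫_ℝ ≠ 0 →
        τ ^ 2 * (ev s * ⟪b s, x⟫_ℝ ^ 2) < ⟪b s, x⟫_ℝ ^ 2 := fun s hs => by
      have h1 : τ ^ 2 * ev s < 1 := not_le.1 fun h => hs (hS s h)
      have h2 : 0 < ⟪b s, x⟫_ℝ ^ 2 := by positivity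
      nlinarith
    refine Finset.sum_lt_sum (fun s _ => ?_) ?_
    · by_cases hs : ⟪b s, x⟫_ℝ = 0
      · simp [hs]
      · exact (hterm s hs).le
    · by_contra! h
      have h0 : ∀ s, ⟪b s, x⟫_ℝ = 0 := fun s => by
        by_contra hs
        exact absurd (hterm s hs) (not_lt.2 (h s (Finset.mem_univ s)))
      have : ‖x‖ ^ 2 = 0 := by simp [← hx2, h0]
      exact hx (by simpa using this)

theorem enorm2_eq_norm {ι : Type*} [Fintype ι] (x : EuclideanSpace ℝ ι) :
    enorm2 (fun i => x i) = ‖x‖ := by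
  simp [enorm2, EuclideanSpace.norm_eq]

/-- Matrices as a Euclidean space, with the Frobenius norm. -/
def matrixToEuclidean (p₁ p₂ : ℕ) :
    Matrix (Fin p₁) (Fin p₂) ℝ ≃ₗ[ℝ] EuclideanSpace ℝ (Fin p₁ × Fin p₂) where
  toFun M := WithLp.toLp 2 fun pq => M pq.1 pq.2
  invFun x := Matrix.of fun p q => x (p, q)
  map_add' _ _ := rfl
  map_smul' _ _ := rfl
  left_inv _ := rfl
  right_inv _ := rfl

/-- The projection of a matrix to its `i`-th column. -/
def euclideanCol {p₁ p₂ : ℕ} (i : Fin p₂) :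
    EuclideanSpace ℝ (Fin p₁ × Fin p₂) →ₗ[ℝ] EuclideanSpace ℝ (Fin p₁) where
  toFun x := WithLp.toLp 2 fun p => x (p, i)
  map_add' _ _ := rfl
  map_smul' _ _ := rfl

theorem sum_norm_sq_euclideanCol {p₁ p₂ : ℕ} (x : EuclideanSpace ℝ (Fin p₁ × Fin p₂)) :
    ∑ i, ‖euclideanCol i x‖ ^ 2 = ‖x‖ ^ 2 := by
  simp only [EuclideanSpace.norm_sq_eq, Fintype.sum_prod_type_right]
  rfl

theorem orthonormal_toLp_of_enorm2 {p d : ℕ} {v : Fin d → Fin p → ℝ}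
    (h1 : ∀ t, enorm2 (v t) = 1) (h2 : ∀ s t, s ≠ t → (∑ p, v s p * v t p) = 0) :
    Orthonormal ℝ fun t => (WithLp.toLp 2 (v t) : EuclideanSpace ℝ (Fin p)) := by
  refine ⟨fun t => ?_, fun s t hst => ?_⟩
  · rw [← enorm2_eq_norm]
    exact h1 t
  · simpa [PiLp.inner_apply, mul_comm] using h2 s t hst

theorem le_robustDim {p₁ p₂ d : ℕ} {V : Submodule ℝ (Matrix (Fin p₁) (Fin p₂) ℝ)} {τ : ℝ}
    {i : Fin p₂} (M : Fin d → V.map (matrixToEuclidean p₁ p₂).toLinearMap)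
    (hM : Orthonormal ℝ fun t => euclideanCol i (M t : EuclideanSpace ℝ (Fin p₁ × Fin p₂)))
    (hτ : ∀ t, ‖M t‖ ≤ τ) : d ≤ robustDim V τ i := by
  refine le_csSup ⟨p₁, ?_⟩ ⟨fun t p => euclideanCol i (M t).1 p,
    fun t => (matrixToEuclidean p₁ p₂).symm (M t), fun t => ?_, fun s t hst => ?_,
    fun t => ⟨?_, ?_, rfl⟩⟩
  · rintro n ⟨v, _, h1, h2, _⟩
    simpa using (orthonormal_toLp_of_enorm2 h1 h2).linearIndependent.fintype_card_le_finrank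
  · rw [enorm2_eq_norm]
    exact hM.1 t
  · simpa [PiLp.inner_apply, mul_comm] using hM.2 hst
  · obtain ⟨N, hN, h⟩ := (M t).2
    have hMN : (matrixToEuclidean p₁ p₂).symm (M t) = N := by
      rw [← h]
      exact (matrixToEuclidean p₁ p₂).symm_apply_apply N
    exact hMN.symm.subst (motive := (· ∈ V)) hN
  · exact (enorm2_eq_norm (M t).1).trans_le (hτ t)

/-- for any subspace 𝒱 of ℝ^{p₁·p₂} and τ ≥ √p₂, the robust dimensions
of the column projections sum to at least dim 𝒱. -/
theorem sum_robust_dim_ge_dim {p₁ p₂ : ℕ}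
    (V : Submodule ℝ (Matrix (Fin p₁) (Fin p₂) ℝ)) (τ : ℝ)
    (hτ : Real.sqrt p₂ ≤ τ) :
    Module.finrank ℝ V ≤ ∑ i : Fin p₂, robustDim V τ i := by
  let E := V.map (matrixToEuclidean p₁ p₂).toLinearMap
  have hpos : ∀ _ : Fin p₂, 0 < τ := fun i =>
    (Real.sqrt_pos.2 (Nat.cast_pos.2 i.pos)).trans_le hτ
  choose d M horth hnorm hlt using fun i : Fin p₂ =>
    ((euclideanCol i).comp E.subtype).exists_orthonormal_image_norm_le (hpos i)
  refine le_trans ?_ (Finset.sum_le_sum fun i _ => le_robustDim (M i) (horth i) (hnorm i))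
  by_contra! hdim
  let L : E →ₗ[ℝ] ((Σ i, Fin (d i)) → ℝ) := LinearMap.pi fun k => innerₛₗ ℝ (M k.1 k.2)
  have hker : LinearMap.ker L ≠ ⊥ := LinearMap.ker_ne_bot_of_finrank_lt <| by
    rw [LinearEquiv.finrank_map_eq]
    simpa using hdim
  obtain ⟨x, hxL, hx⟩ := Submodule.exists_mem_ne_zero_of_ne_bot hker
  have hcol : ∀ i, τ ^ 2 * ‖euclideanCol i x.1‖ ^ 2 < ‖x‖ ^ 2 := fun i =>
    hlt i x hx fun t => congrFun (LinearMap.mem_ker.1 hxL) ⟨i, t⟩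
  have hsum : ∑ i, ‖euclideanCol i x.1‖ ^ 2 = ‖x‖ ^ 2 := sum_norm_sq_euclideanCol x.1
  have hx0 : 0 < ‖x‖ ^ 2 := by positivity
  have hne : (Finset.univ : Finset (Fin p₂)).Nonempty := by
    by_contra! h
    rw [h, Finset.sum_empty] at hsum
    exact hx0.ne hsum
  have h := Finset.sum_lt_sum_of_nonempty hne fun i _ => hcol i
  rw [← Finset.mul_sum, hsum, Finset.sum_const, Finset.card_univ, Fintype.card_fin,
    nsmul_eq_mul] at h
  exact absurd (lt_of_mul_lt_mul_right h hx0.le) (not_lt.2 (Real.sqrt_le_iff.1 hτ).2)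

end
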